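/- (Lemma 2.3.1) Let p ≥ 1, σ > 0, δ > 0, and let k be the squared-exponential kernel on ℝ^p. Let (x⁽¹⁾, α⁽¹⁾), …, (x⁽ᵐ⁾, α⁽ᵐ⁾) be pairs consisting of a point x⁽ⁱ⁾ ∈ ℝ^p and a multi-index α⁽ⁱ⁾ : Fin p → ℕ. Then the m × m matrix K_der with entries (K_der)_{ij} = ∂_x^{α⁽ⁱ⁾} ∂_y^{α⁽ʲ⁾} k(x,y) evaluated at (x,y) = (x⁽ⁱ⁾, x⁽ʲ⁾) is symmetric and positive semidefinite; moreover, if the pairs (x⁽ⁱ⁾, α⁽ⁱ⁾) are pairwise distinct, K_der is positive definite. -/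

import Mathlib

/-- The squared-exponential (SE) kernel on `ℝ^p` with signal variance `σ²` and
length scale `δ`: `k(x,y) = σ² · exp(−‖x−y‖²/(2δ²))`. -/
noncomputable def seKernel (p : ℕ) (σ δ : ℝ) (x y : Fin p → ℝ) : ℝ :=
  σ ^ 2 * Real.exp (-(∑ i, (x i - y i) ^ 2) / (2 * δ ^ 2))

/-- Partial derivative of `f : ℝ^p → ℝ` in the `i`-th coordinate direction. -/
noncomputable def coordDeriv {p : ℕ} (i : Fin p) (f : (Fin p → ℝ) → ℝ) :
    (Fin p → ℝ) → ℝ :=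
  fun x => fderiv ℝ f x (Pi.single i 1)

/-- Mixed partial derivative `∂^α f` for a multi-index `α : Fin p → ℕ`. -/
noncomputable def multiDeriv {p : ℕ} (α : Fin p → ℕ) (f : (Fin p → ℝ) → ℝ) :
    (Fin p → ℝ) → ℝ :=
  (List.finRange p).foldr (fun i g => (coordDeriv i)^[α i] g) f

/-- `∂_x^α ∂_y^β k(x,y)` for a two-variable kernel `k`. -/
noncomputable def mixedDeriv {p : ℕ} (α β : Fin p → ℕ)
    (k : (Fin p → ℝ) → (Fin p → ℝ) → ℝ) (x y : Fin p → ℝ) : ℝ :=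
  multiDeriv α (fun x' => multiDeriv β (fun y' => k x' y') y) x

universe u

section

open MeasureTheory Filter Asymptotics

/-- A coefficient family annihilating the functions `r ↦ r ^ a * exp (s * r)`, for distinct pairs
`(s, a)`, vanishes. -/
theorem eq_zero_of_sum_pow_mul_exp_eq_zero {ι : Type*} [Fintype ι] (u : ι → ℝ × ℕ)
    (hu : Function.Injective u) (c : ι → ℝ)
    (h : ∀ r : ℝ, ∑ i, c i * (r ^ (u i).2 * Real.exp ((u i).1 * r)) = 0) : c = 0 := by
  classical
  by_contra hc
  obtain ⟨i₀, hi₀⟩ := Function.ne_iff.mp hc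
  obtain ⟨j, hj, hmax⟩ := (Finset.univ.filter fun i => c i ≠ 0).exists_max_image
    (fun i => toLex (u i)) ⟨i₀, by simpa using hi₀⟩
  have hj' : c j ≠ 0 := by simpa using hj
  have hsmall : ∀ i ∈ Finset.univ.erase j,
      (fun r : ℝ => c i * (r ^ (u i).2 * Real.exp ((u i).1 * r))) =o[atTop]
        fun r : ℝ => r ^ (u j).2 * Real.exp ((u j).1 * r) := by
    intro i hi
    by_cases hci : c i = 0
    · simp [hci]
    have hle := hmax i (by simpa using hci)
    have hne : u i ≠ u j := fun e => (Finset.ne_of_mem_erase hi) (hu e)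
    have hlt : toLex (u i) < toLex (u j) := lt_of_le_of_ne hle (by simpa using hne)
    refine IsLittleO.const_mul_left ?_ _
    rcases Prod.Lex.toLex_lt_toLex.mp hlt with hs | ⟨hs, ha⟩
    · have h1 := isLittleO_pow_exp_pos_mul_atTop (u i).2 (sub_pos.mpr hs)
      have h2 : (fun r : ℝ => r ^ (u i).2 * Real.exp ((u i).1 * r)) =o[atTop]
          fun r : ℝ => Real.exp ((u j).1 * r) := by
        refine (h1.mul_isBigO (isBigO_refl (fun r : ℝ => Real.exp ((u i).1 * r)) _)).congr_right ?_
        intro r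
        rw [← Real.exp_add]
        ring_nf
      refine h2.trans_isBigO (IsBigO.of_bound 1 ?_)
      filter_upwards [eventually_ge_atTop (1 : ℝ)] with r hr
      rw [one_mul, norm_mul]
      refine le_mul_of_one_le_left (norm_nonneg _) ?_
      rw [norm_pow]
      exact one_le_pow₀ (hr.trans (le_abs_self r))
    · rw [hs]
      exact (isLittleO_pow_pow_atTop_of_lt ha).mul_isBigO (isBigO_refl _ _)
  have hsum := IsLittleO.sum hsmall
  have hself : (fun r : ℝ => r ^ (u j).2 * Real.exp ((u j).1 * r)) =o[atTop]
      fun r : ℝ => r ^ (u j).2 * Real.exp ((u j).1 * r) := by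
    refine (hsum.const_mul_left (-(c j)⁻¹)).congr_left fun r => ?_
    have h1 := h r
    rw [← Finset.add_sum_erase _ _ (Finset.mem_univ j)] at h1
    rw [Finset.sum_apply, eq_neg_of_add_eq_zero_right h1]
    field_simp
  refine isLittleO_irrefl' (Eventually.frequently ?_) hself
  filter_upwards [eventually_gt_atTop (0 : ℝ)] with r hr
  exact norm_ne_zero_iff.mpr (mul_pos (pow_pos hr _) (Real.exp_pos _)).ne'

/-- A coefficient family annihilating the functions `ω ↦ (iω) ^ a * exp (iωs)`, for distinct pairs
`(s, a)`, vanishes. -/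
theorem eq_zero_of_sum_pow_mul_cexp_eq_zero {ι : Type*} [Fintype ι] (u : ι → ℝ × ℕ)
    (hu : Function.Injective u) (c : ι → ℝ)
    (h : ∀ w : ℝ, ∑ i, (c i : ℂ) * ((w * Complex.I) ^ (u i).2 *
      Complex.exp ((u i).1 * (w * Complex.I))) = 0) : c = 0 := by
  have hana : AnalyticOnNhd ℂ (fun z : ℂ => ∑ i, (c i : ℂ) * ((z * Complex.I) ^ (u i).2 *
      Complex.exp ((u i).1 * (z * Complex.I)))) Set.univ :=
    fun z _ => Differentiable.analyticAt (by fun_prop) z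
  have hzero := AnalyticOnNhd.eq_of_frequently_eq (z₀ := 0) hana
    (analyticOnNhd_const (v := (0 : ℂ))) (by
      have ht : Tendsto (fun w : ℝ => (w : ℂ)) (nhdsWithin 0 {0}ᶜ) (nhdsWithin 0 {0}ᶜ) := by
        refine tendsto_nhdsWithin_iff.mpr ⟨?_, ?_⟩
        · exact (Complex.continuous_ofReal.tendsto' 0 0 (by simp)).mono_left nhdsWithin_le_nhds
        · filter_upwards [self_mem_nhdsWithin] with w hw
          simpa using hw
      exact ht.frequently (Eventually.of_forall h).frequently)
  refine eq_zero_of_sum_pow_mul_exp_eq_zero u hu c fun r => ?_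
  have h1 := congrFun hzero (-(r * Complex.I))
  have h2 : -((r : ℂ) * Complex.I) * Complex.I = r := by
    rw [neg_mul, mul_assoc, Complex.I_mul_I]; ring
  simp only [h2] at h1
  exact_mod_cast h1

/-- A real matrix which is the Gram matrix of continuous complex-valued `L²` functions is positive
definite if these functions are linearly independent over the reals. -/
theorem posDef_of_integral_mul_conj {ι X : Type*} [Fintype ι] [TopologicalSpace X]
    [MeasurableSpace X] (μ : Measure X) [μ.IsOpenPosMeasure] (M : Matrix ι ι ℝ) (φ : ι → X → ℂ)
    (hφ : ∀ i, Continuous (φ i))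
    (hint : ∀ i j, Integrable (fun w => φ i w * starRingEnd ℂ (φ j w)) μ)
    (hM : ∀ i j, (M i j : ℂ) = ∫ w, φ i w * starRingEnd ℂ (φ j w) ∂μ)
    (hind : ∀ c : ι → ℝ, (∀ w, ∑ i, (c i : ℂ) * φ i w = 0) → c = 0) : M.PosDef := by
  refine Matrix.PosDef.of_dotProduct_mulVec_pos ?_ fun c hc => ?_
  · ext i j
    rw [Matrix.conjTranspose_apply, star_trivial]
    apply Complex.ofReal_injective
    rw [hM, ← Complex.conj_ofReal, hM, ← integral_conj]
    simp [mul_comm]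
  set F : X → ℂ := fun w => ∑ i, (c i : ℂ) * φ i w with hF
  have hFc : Continuous F := by fun_prop
  have hexp : ∀ w, ((Complex.normSq (F w) : ℝ) : ℂ) =
      ∑ i, ∑ j, (c i : ℂ) * c j * (φ i w * starRingEnd ℂ (φ j w)) := by
    intro w
    rw [← Complex.mul_conj, hF]
    simp only [map_sum, map_mul, Complex.conj_ofReal, Finset.sum_mul_sum]
    refine Finset.sum_congr rfl fun i _ => Finset.sum_congr rfl fun j _ => ?_
    ring
  have hintC : Integrable (fun w => ((Complex.normSq (F w) : ℝ) : ℂ)) μ := by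
    simp only [hexp]
    exact integrable_finsetSum _ fun i _ => integrable_finsetSum _ fun j _ =>
      (hint i j).const_mul _
  have hintR : Integrable (fun w => Complex.normSq (F w)) μ := by
    simpa using hintC.re
  have hquad : star c ⬝ᵥ M.mulVec c = ∫ w, Complex.normSq (F w) ∂μ := by
    apply Complex.ofReal_injective
    rw [← integral_complex_ofReal]
    simp only [hexp]
    rw [integral_finsetSum _ fun i _ => integrable_finsetSum _ fun j _ =>
      (hint i j).const_mul _]
    simp only [dotProduct, Matrix.mulVec, star_trivial, Finset.mul_sum, Complex.ofReal_sum]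
    refine Finset.sum_congr rfl fun i _ => ?_
    rw [integral_finsetSum _ fun j _ => (hint i j).const_mul _]
    refine Finset.sum_congr rfl fun j _ => ?_
    rw [integral_const_mul, ← hM]
    push_cast
    ring
  rw [hquad]
  have hnn : 0 ≤ fun w => Complex.normSq (F w) := fun w => Complex.normSq_nonneg _
  refine lt_of_le_of_ne (integral_nonneg hnn) fun h0 => hc (hind c fun w => ?_)
  have hae := (integral_eq_zero_iff_of_nonneg hnn hintR).mp h0.symm
  have h1 := (Continuous.ae_eq_iff_eq μ (Complex.continuous_normSq.comp hFc)
    continuous_const).mp hae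
  exact Complex.normSq_eq_zero.mp (congrFun h1 w)

theorem iteratedDeriv_ofReal_comp {f : ℝ → ℝ} (hf : ContDiff ℝ ⊤ f) (n : ℕ) :
    iteratedDeriv n (fun t => (f t : ℂ)) = fun t => ((iteratedDeriv n f t : ℝ) : ℂ) := by
  induction n with
  | zero => simp
  | succ n ih =>
    rw [iteratedDeriv_succ, ih, iteratedDeriv_succ]
    funext t
    exact ((hf.differentiable_iteratedDeriv n (by simp) t).hasDerivAt.ofReal_comp).deriv

/-- The one-dimensional squared-exponential profile. -/
noncomputable def gaussProfile (δ t : ℝ) : ℝ := Real.exp (-t ^ 2 / (2 * δ ^ 2))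

theorem contDiff_gaussProfile (δ : ℝ) {n : WithTop ℕ∞} : ContDiff ℝ n (gaussProfile δ) := by
  unfold gaussProfile
  fun_prop

/-- The mixed derivative kernel `∂ₛᵃ ∂ₜᵇ` of the one-dimensional squared-exponential kernel. -/
noncomputable def gaussDerivKernel (δ : ℝ) (u v : ℝ × ℕ) : ℝ :=
  (-1) ^ v.2 * iteratedDeriv (u.2 + v.2) (gaussProfile δ) (u.1 - v.1)

theorem posDef_gaussDerivKernel {δ : ℝ} (hδ : 0 < δ) {ι : Type*} [Fintype ι] (u : ι → ℝ × ℕ)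
    (hu : Function.Injective u) :
    (Matrix.of fun i j => gaussDerivKernel δ (u i) (u j)).PosDef := by
  set v : NNReal := ⟨(δ ^ 2)⁻¹, by positivity⟩ with hv
  have hv0 : v ≠ 0 := by
    rw [ne_eq, ← NNReal.coe_eq_zero]
    exact (by positivity : (δ ^ 2)⁻¹ ≠ 0)
  set μ := ProbabilityTheory.gaussianReal 0 v
  have : μ.IsOpenPosMeasure :=
    (ProbabilityTheory.gaussianReal_absolutelyContinuous' 0 hv0).isOpenPosMeasure
  have hchar : charFun μ = fun t => (gaussProfile δ t : ℂ) := by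
    funext t
    rw [ProbabilityTheory.charFun_gaussianReal, gaussProfile, Complex.ofReal_exp]
    congr 1
    rw [show (v : ℝ) = (δ ^ 2)⁻¹ from rfl]
    push_cast
    field_simp
    ring
  have hconj : ∀ (i j : ι) (w : ℝ), (w * Complex.I) ^ (u i).2 *
      Complex.exp ((u i).1 * (w * Complex.I)) * starRingEnd ℂ ((w * Complex.I) ^ (u j).2 *
      Complex.exp ((u j).1 * (w * Complex.I))) =
      ((-1) ^ (u j).2 * Complex.I ^ ((u i).2 + (u j).2)) * ((w : ℂ) ^ ((u i).2 + (u j).2) *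
        Complex.exp (((u i).1 - (u j).1 : ℝ) * w * Complex.I)) := by
    intro i j w
    have he : Complex.exp (((u i).1 - (u j).1 : ℝ) * w * Complex.I) =
        Complex.exp ((u i).1 * (w * Complex.I)) * Complex.exp (-((u j).1 * (w * Complex.I))) := by
      rw [← Complex.exp_add]
      push_cast
      ring_nf
    have hs : starRingEnd ℂ (Complex.exp ((u j).1 * (w * Complex.I))) =
        Complex.exp (-((u j).1 * (w * Complex.I))) := by
      rw [← Complex.exp_conj]
      simp
    rw [map_mul, hs, he, map_pow, map_mul, Complex.conj_ofReal, Complex.conj_I, mul_neg, neg_pow]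
    ring
  refine posDef_of_integral_mul_conj μ _ (fun i (w : ℝ) => (w * Complex.I) ^ (u i).2 *
      Complex.exp ((u i).1 * (w * Complex.I))) (fun i => by fun_prop) (fun i j => ?_)
      (fun i j => ?_) fun c hc => eq_zero_of_sum_pow_mul_cexp_eq_zero u hu c hc
  · simp only [hconj]
    refine Integrable.const_mul ?_ _
    have hmem : Integrable (fun w : ℝ => ‖id w‖ ^ ((u i).2 + (u j).2)) μ :=
      MemLp.integrable_norm_pow' (by
        exact_mod_cast ProbabilityTheory.memLp_id_gaussianReal (((u i).2 + (u j).2 : ℕ) : NNReal))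
    refine hmem.mono' (by fun_prop) (Eventually.of_forall fun w => ?_)
    rw [norm_mul, norm_pow, ← Complex.ofReal_mul, Complex.norm_exp_ofReal_mul_I]
    simp
  · simp only [hconj]
    rw [integral_const_mul, mul_assoc, ← iteratedDeriv_charFun (by
      exact_mod_cast ProbabilityTheory.memLp_id_gaussianReal (((u i).2 + (u j).2 : ℕ) : NNReal)),
      hchar, iteratedDeriv_ofReal_comp (contDiff_gaussProfile δ)]
    simp [gaussDerivKernel]

/-- If the matrices of `K` at finitely many distinct points are positive definite, so are those of
the `p`-fold product kernel of `K`. -/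
theorem posDef_prod_kernel {S : Type u} (K : S → S → ℝ)
    (hK : ∀ {n : ℕ} (u : Fin n → S), Function.Injective u →
      (Matrix.of fun i j => K (u i) (u j)).PosDef) (p : ℕ) {ι : Type u} [Finite ι]
    (u : ι → Fin p → S) (hu : Function.Injective u) :
    (Matrix.of fun i j => ∏ l, K (u i l) (u j l)).PosDef := by
  classical
  have hK' : ∀ {ι : Type u} [Finite ι] (u : ι → S), Function.Injective u →
      (Matrix.of fun i j => K (u i) (u j)).PosDef := by
    intro ι _ u hu
    obtain ⟨n, ⟨e⟩⟩ := Finite.exists_equiv_fin ι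
    have h := (hK (u ∘ e.symm) (hu.comp e.symm.injective)).submatrix e.injective
    simpa [Matrix.submatrix] using h
  induction p generalizing ι with
  | zero =>
    have : Subsingleton ι := ⟨fun i j => hu (Subsingleton.elim _ _)⟩
    have : (Matrix.of fun i j : ι => ∏ l, K (u i l) (u j l)) = 1 := by
      ext i j
      obtain rfl := Subsingleton.elim i j
      simp
    rw [this]
    exact Matrix.PosDef.one
  | succ p ih =>
    have hA := hK' (fun a : Set.range fun i => u i 0 => (a : S)) Subtype.val_injective
    have hB := ih (fun b : Set.range fun i => Fin.tail (u i) => (b : Fin p → S))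
      Subtype.val_injective
    have he : Function.Injective fun i => ((⟨u i 0, i, rfl⟩, ⟨Fin.tail (u i), i, rfl⟩) :
        (Set.range fun i => u i 0) × (Set.range fun i => Fin.tail (u i))) := by
      intro i j hij
      obtain ⟨h0, ht⟩ := Prod.ext_iff.mp hij
      have h0' : u i 0 = u j 0 := congrArg Subtype.val h0
      have ht' : Fin.tail (u i) = Fin.tail (u j) := congrArg Subtype.val ht
      apply hu
      rw [← Fin.cons_self_tail (u i), ← Fin.cons_self_tail (u j), h0', ht']
    simp only [Fin.prod_univ_succ]
    exact (hA.kronecker hB).submatrix he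

theorem coordDeriv_const_mul_prod {p : ℕ} (i : Fin p) (C : ℝ) (h : Fin p → ℝ → ℝ)
    (hh : ∀ j, Differentiable ℝ (h j)) :
    coordDeriv i (fun x => C * ∏ j, h j (x j)) =
      fun x => C * ∏ j, Function.update h i (deriv (h i)) j (x j) := by
  funext x
  have hd : DifferentiableAt ℝ (fun x : Fin p → ℝ => C * ∏ j, h j (x j)) x := by
    have hj : ∀ j, Differentiable ℝ fun x : Fin p → ℝ => h j (x j) := fun j =>
      (hh j).comp (differentiable_apply j)
    fun_prop
  rw [coordDeriv, ← hd.lineDeriv_eq_fderiv, lineDeriv]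
  have hsplit : ∀ t : ℝ, C * ∏ j, h j ((x + t • (Pi.single i (1 : ℝ) : Fin p → ℝ)) j) =
      C * (∏ j ∈ Finset.univ.erase i, h j (x j)) * h i (x i + t) := by
    intro t
    rw [← Finset.mul_prod_erase _ _ (Finset.mem_univ i), mul_assoc, mul_comm (h i _)]
    have : ∏ j ∈ Finset.univ.erase i, h j ((x + t • (Pi.single i (1 : ℝ) : Fin p → ℝ)) j) =
        ∏ j ∈ Finset.univ.erase i, h j (x j) :=
      Finset.prod_congr rfl fun j hj => by simp [Finset.ne_of_mem_erase hj]
    rw [this]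
    simp
  simp only [hsplit]
  rw [deriv_const_mul_field, deriv_comp_const_add, add_zero,
    ← Finset.mul_prod_erase _ _ (Finset.mem_univ i), Function.update_self, mul_assoc,
    mul_comm (deriv _ _)]
  congr 2
  exact Finset.prod_congr rfl fun j hj => by rw [Function.update_of_ne (Finset.ne_of_mem_erase hj)]

theorem contDiff_iteratedDeriv {f : ℝ → ℝ} (hf : ContDiff ℝ ⊤ f) (n : ℕ) :
    ContDiff ℝ ⊤ (iteratedDeriv n f) := by
  induction n with
  | zero => simpa using hf
  | succ n ih =>
    rw [iteratedDeriv_succ]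
    exact ContDiff.deriv' ih

theorem iterate_coordDeriv_const_mul_prod {p : ℕ} (i : Fin p) (n : ℕ) (C : ℝ)
    (h : Fin p → ℝ → ℝ) (hh : ∀ j, ContDiff ℝ ⊤ (h j)) :
    (coordDeriv i)^[n] (fun x => C * ∏ j, h j (x j)) =
      fun x => C * ∏ j, Function.update h i (iteratedDeriv n (h i)) j (x j) := by
  induction n with
  | zero => simp
  | succ n ih =>
    rw [Function.iterate_succ_apply', ih, coordDeriv_const_mul_prod]
    · simp [iteratedDeriv_succ]
    · intro j
      rcases eq_or_ne j i with rfl | hj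
      · simpa using (contDiff_iteratedDeriv (hh j) n).differentiable (by simp)
      · simpa [hj] using (hh j).differentiable (by simp)

/-- Partial derivatives of a product of functions of one coordinate each. -/
theorem multiDeriv_const_mul_prod {p : ℕ} (α : Fin p → ℕ) (C : ℝ) (h : Fin p → ℝ → ℝ)
    (hh : ∀ j, ContDiff ℝ ⊤ (h j)) :
    multiDeriv α (fun x => C * ∏ j, h j (x j)) =
      fun x => C * ∏ j, iteratedDeriv (α j) (h j) (x j) := by
  have key : ∀ l : List (Fin p), l.Nodup →
      l.foldr (fun i g => (coordDeriv i)^[α i] g) (fun x => C * ∏ j, h j (x j)) =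
        fun x => C * ∏ j, (if j ∈ l then iteratedDeriv (α j) (h j) else h j) (x j) := by
    intro l
    induction l with
    | nil => simp
    | cons i l ih =>
      intro hl
      rw [List.nodup_cons] at hl
      rw [List.foldr_cons, ih hl.2, iterate_coordDeriv_const_mul_prod]
      · funext x
        congr 1
        refine Finset.prod_congr rfl fun j _ => ?_
        rcases eq_or_ne j i with rfl | hj
        · simp [hl.1]
        · simp [hj]
      · intro j
        split_ifs
        exacts [contDiff_iteratedDeriv (hh j) _, hh j]
  simpa [multiDeriv] using key _ (List.nodup_finRange p)

theorem mixedDeriv_seKernel (p : ℕ) (σ δ : ℝ) (α β : Fin p → ℕ) (x y : Fin p → ℝ) :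
    mixedDeriv α β (seKernel p σ δ) x y =
      σ ^ 2 * ∏ l, gaussDerivKernel δ (x l, α l) (y l, β l) := by
  have hk : ∀ x' : Fin p → ℝ, (fun y' => seKernel p σ δ x' y') =
      fun y' => σ ^ 2 * ∏ l, (fun t => gaussProfile δ (x' l - t)) (y' l) := by
    intro x'
    funext y'
    simp only [seKernel, gaussProfile]
    rw [← Real.exp_sum, ← Finset.sum_div, Finset.sum_neg_distrib]
  have hinner : ∀ x' : Fin p → ℝ, multiDeriv β (fun y' => seKernel p σ δ x' y') y =
      σ ^ 2 * ∏ l, (fun s => (-1) ^ β l * iteratedDeriv (β l) (gaussProfile δ) (s - y l))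
        (x' l) := by
    intro x'
    rw [hk, multiDeriv_const_mul_prod _ _ (fun l t => gaussProfile δ (x' l - t)) fun l =>
      (contDiff_gaussProfile δ).comp (contDiff_const.sub contDiff_id)]
    simp only [iteratedDeriv_comp_const_sub, smul_eq_mul]
  have hsm : ∀ n : ℕ, ContDiff ℝ ⊤ (iteratedDeriv n (gaussProfile δ)) :=
    contDiff_iteratedDeriv (contDiff_gaussProfile δ)
  rw [mixedDeriv, funext hinner, multiDeriv_const_mul_prod _ _
    (fun l s => (-1) ^ β l * iteratedDeriv (β l) (gaussProfile δ) (s - y l)) fun l =>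
      contDiff_const.mul ((hsm _).comp (contDiff_id.sub contDiff_const))]
  dsimp only
  congr 1
  refine Finset.prod_congr rfl fun l _ => ?_
  rw [iteratedDeriv_const_mul_field, iteratedDeriv_comp_sub_const, gaussDerivKernel]
  simp only [iteratedDeriv_eq_iterate, Function.iterate_add_apply]

end

/-- Lemma 2.3.1: the derivative-informed covariance matrix of the squared-exponential
kernel is symmetric and positive semidefinite; if the (point, multi-index) pairs are
pairwise distinct, it is positive definite. -/
theorem derivative_gram_symm_posSemidef_posDef (p m : ℕ) (hp : 1 ≤ p) (σ δ : ℝ)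
    (hσ : 0 < σ) (hδ : 0 < δ)
    (x : Fin m → (Fin p → ℝ)) (α : Fin m → (Fin p → ℕ)) :
    (Matrix.of fun i j : Fin m =>
        mixedDeriv (α i) (α j) (seKernel p σ δ) (x i) (x j)).IsSymm ∧
      (Matrix.of fun i j : Fin m =>
        mixedDeriv (α i) (α j) (seKernel p σ δ) (x i) (x j)).PosSemidef ∧
      (Function.Injective (fun i => (x i, α i)) →
        (Matrix.of fun i j : Fin m =>
          mixedDeriv (α i) (α j) (seKernel p σ δ) (x i) (x j)).PosDef) := by
  have hK : ∀ {n : ℕ} (u : Fin n → ℝ × ℕ), Function.Injective u →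
      (Matrix.of fun i j => gaussDerivKernel δ (u i) (u j)).PosDef :=
    fun u hu => posDef_gaussDerivKernel hδ u hu
  have hpos : ∀ {ι : Type} [Finite ι] (x : ι → Fin p → ℝ) (α : ι → Fin p → ℕ),
      Function.Injective (fun i => (x i, α i)) → (Matrix.of fun i j =>
        mixedDeriv (α i) (α j) (seKernel p σ δ) (x i) (x j)).PosDef := by
    intro ι _ x α hinj
    have hu : Function.Injective fun i l => (x i l, α i l) := by
      intro i j hij
      apply hinj
      simp only [funext_iff, Prod.mk.injEq] at hij
      exact Prod.ext (funext fun l => (hij l).1) (funext fun l => (hij l).2)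
    have h := (posDef_prod_kernel _ hK p _ hu).smul (pow_pos hσ 2)
    simp only [mixedDeriv_seKernel]
    exact h
  have hpsd : (Matrix.of fun i j : Fin m =>
      mixedDeriv (α i) (α j) (seKernel p σ δ) (x i) (x j)).PosSemidef :=
    (hpos (fun a : Set.range fun i => (x i, α i) => a.1.1) (fun a => a.1.2)
      Subtype.val_injective).posSemidef.submatrix fun i => ⟨(x i, α i), i, rfl⟩
  refine ⟨?_, hpsd, hpos x α⟩
  exact (Matrix.conjTranspose_eq_transpose_of_trivial _).symm.trans hpsd.isHermitian
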